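/- For any hypergraph F with n vertices and any integer r ≥ 2, one has n − alt_r(F) ≥ cd_r(F). -/

import Mathlib

/-- `X` has an alternating subsequence of length `m`. -/
def HasAltSeq {n r : ℕ} (X : Fin n → Option (ZMod r)) (m : ℕ) : Prop :=
  ∃ s : Fin m → Fin n, StrictMono s ∧ (∀ j, X (s j) ≠ none) ∧
    ∀ (j : ℕ) (h : j + 1 < m), X (s ⟨j, by omega⟩) ≠ X (s ⟨j + 1, h⟩)

/-- `alt(X)`: the maximum length of an alternating subsequence of `X`. -/
noncomputable def altVec {n r : ℕ} (X : Fin n → Option (ZMod r)) : ℕ :=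
  sSup {m | HasAltSeq X m}

/-- `alt_r(F, σ)`. -/
noncomputable def altSigma {V : Type*} {n : ℕ} (E : Set (Finset V)) (r : ℕ)
    (σ : Fin n ≃ V) : ℕ :=
  sSup {a | ∃ X : Fin n → Option (ZMod r), a = altVec X ∧
    ∀ ε : ZMod r, ∀ e ∈ E, ¬ ((e : Set V) ⊆ σ '' {i | X i = some ε})}

/-- `alt_r(F)`: the minimum of `alt_r(F, σ)` over all bijections `σ`. -/
noncomputable def altHyp {V : Type*} [Fintype V] (E : Set (Finset V)) (r : ℕ) : ℕ :=
  sInf {a | ∃ σ : Fin (Fintype.card V) ≃ V, a = altSigma E r σ}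

/-- The `r`-colorability defect `cd_r(F)`: the minimum size of a set `U` of vertices
such that the induced subhypergraph on the remaining vertices is `r`-colorable. -/
noncomputable def cdr {V : Type*} [Fintype V] [DecidableEq V]
    (E : Set (Finset V)) (r : ℕ) : ℕ :=
  sInf {k | ∃ U : Finset V, U.card = k ∧ ∃ c : V → Fin r,
    ∀ e ∈ E, (∀ v ∈ e, v ∉ U) → ∃ u ∈ e, ∃ w ∈ e, c u ≠ c w}

/-- For any hypergraph `F` with `n` vertices and any `r ≥ 2`,
`n − alt_r(F) ≥ cd_r(F)`. -/
theorem cd_le_card_sub_alt {V : Type*} [Fintype V] [DecidableEq V]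
    (E : Set (Finset V)) (hne : ∀ e ∈ E, e.Nonempty) (r : ℕ) (hr : 2 ≤ r) :
    cdr E r ≤ Fintype.card V - altHyp E r := by
  obtain ⟨r, rfl⟩ : ∃ k, r = k + 2 := ⟨r - 2, by omega⟩
  let σ : Fin (Fintype.card V) ≃ V := (Fintype.equivFin V).symm
  have hb : ∀ (X : Fin (Fintype.card V) → Option (ZMod (r + 2))) (m : ℕ), HasAltSeq X m →
      m ≤ (Finset.univ.filter (fun i => X i ≠ none)).card := by
    rintro X m ⟨s, hs, hn, -⟩
    have := Finset.card_le_card_of_injOn (s := (Finset.univ : Finset (Fin m)))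
      (t := Finset.univ.filter (fun i => X i ≠ none)) s
      (by intro j _; simpa using hn j) (hs.injective.injOn)
    simpa using this
  have hv : ∀ (X : Fin (Fintype.card V) → Option (ZMod (r + 2))),
      altVec X ≤ (Finset.univ.filter (fun i => X i ≠ none)).card := by
    intro X
    exact csSup_le' (fun m hm => hb X m hm)
  have h1 : altHyp E (r + 2) ≤ altSigma E (r + 2) σ := Nat.sInf_le ⟨σ, rfl⟩
  have h2 : altSigma E (r + 2) σ ∈ {a | ∃ X : Fin (Fintype.card V) → Option (ZMod (r + 2)),
      a = altVec X ∧ ∀ ε : ZMod (r + 2), ∀ e ∈ E,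
        ¬ ((e : Set V) ⊆ σ '' {i | X i = some ε})} := by
    apply Nat.sSup_mem
    · refine ⟨_, fun _ => none, rfl, ?_⟩
      intro ε e he hsub
      obtain ⟨v, hvv⟩ := hne e he
      have := hsub (Finset.mem_coe.2 hvv)
      simp at this
    · refine ⟨Fintype.card V, ?_⟩
      rintro a ⟨X, rfl, -⟩
      refine (hv X).trans ((Finset.card_le_univ _).trans ?_)
      simp
  obtain ⟨X, hX, hE⟩ := h2
  let S := Finset.univ.filter (fun i => X i ≠ none)
  let U : Finset V := (S.map σ.toEmbedding)ᶜ
  have hU : U.card = Fintype.card V - S.card := by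
    simp [U, Finset.card_compl]
  have h3 : cdr E (r + 2) ≤ U.card := by
    refine Nat.sInf_le ⟨U, rfl, fun v => ((X (σ.symm v)).getD 0 : ZMod (r + 2)), ?_⟩
    intro e he hd
    by_contra hcon
    push Not at hcon
    obtain ⟨v, hvv⟩ := hne e he
    refine hE ((X (σ.symm v)).getD 0) e he ?_
    intro w hw
    refine ⟨σ.symm w, ?_, by simp⟩
    have hw' := hd w hw
    have hne' : X (σ.symm w) ≠ none := by
      intro h0
      apply hw'
      simp only [U, S, Finset.mem_compl, Finset.mem_map, Finset.mem_filter]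
      rintro ⟨i, ⟨-, hi⟩, rfl⟩
      exact hi (by simpa using h0)
    have heq := hcon w hw v hvv
    obtain ⟨x, hx⟩ := Option.ne_none_iff_exists'.1 hne'
    simp only [Set.mem_setOf_eq]
    rw [← heq, hx]
    rfl
  have h4 := hv X
  change _ ≤ S.card at h4
  omega
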